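/- Let ξ ~ N(μ, Σ) in ℝ^{2k}, ζ ~ N(0,Σ) independent of ξ, ξ^{(a)} = ξ + ζ. Suppose the weights are deterministic: ŵ(ξ^{(b)}) = w for a fixed vector w. If the mean parameter ranges over a set such that each 2-dimensional marginal family is complete, then E[Σ_i w_i β̂_U(ξ^{(a)}(i), 2Σ(i)) | ξ] = Σ_i w_i β̂_U(ξ(i), Σ(i)) almost surely. -/

import Mathlib

open MeasureTheory ProbabilityTheory Filter Matrix

/-- Standard normal density `φ`. -/
noncomputable def stdPDF (x : ℝ) : ℝ :=
  (Real.sqrt (2 * Real.pi))⁻¹ * Real.exp (-(x ^ 2) / 2)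

/-- Standard normal CDF `Φ`. -/
noncomputable def stdCDF (x : ℝ) : ℝ := ∫ t in Set.Iic x, stdPDF t

/-- Mills-ratio estimator `τ̂(x, σ²) = (1/σ)(1 − Φ(x/σ))/φ(x/σ)`. -/
noncomputable def millsTau (σ x : ℝ) : ℝ :=
  (1 / σ) * (1 - stdCDF (x / σ)) / stdPDF (x / σ)

/-- The multivariate normal distribution N(μ, AAᵀ) on ι → ℝ. -/
noncomputable def mvGaussian {ι : Type*} [Fintype ι] (μ : ι → ℝ)
    (A : Matrix ι ι ℝ) : Measure (ι → ℝ) :=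
  (Measure.pi fun _ : ι => gaussianReal 0 1).map (fun z => μ + A.mulVec z)

/-- Single-instrument unbiased estimator β̂_U(x, Ω) with covariance entries s₁₂, s₂₂. -/
noncomputable def betaU (x₁ x₂ s₁₂ s₂₂ : ℝ) : ℝ :=
  millsTau (Real.sqrt s₂₂) x₂ * (x₁ - (s₁₂ / s₂₂) * x₂) + s₁₂ / s₂₂


lemma stdPDF_pos (x : ℝ) : 0 < stdPDF x := by
  unfold stdPDF; positivity

lemma stdPDF_eq : stdPDF = gaussianPDFReal 0 1 := by
  ext x; simp [stdPDF, gaussianPDFReal]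

lemma integrable_stdPDF : Integrable stdPDF := by
  rw [stdPDF_eq]; exact integrable_gaussianPDFReal 0 1

lemma one_sub_stdCDF (x : ℝ) : 1 - stdCDF x = ∫ t in Set.Ioi x, stdPDF t := by
  have h := intervalIntegral.integral_Iic_add_Ioi (b := x) (f := stdPDF) (μ := volume)
    integrable_stdPDF.integrableOn integrable_stdPDF.integrableOn
  have h2 : ∫ t, stdPDF t = 1 := by
    rw [stdPDF_eq]; exact integral_gaussianPDFReal_eq_one 0 (by simp)
  unfold stdCDF
  linarith

lemma stdPDF_shift (σ x u : ℝ) (hσ : 0 < σ) :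
    stdPDF (x / σ + σ * u) = stdPDF (x / σ) * Real.exp (-u * x - u ^ 2 * σ ^ 2 / 2) := by
  unfold stdPDF
  rw [mul_assoc, ← Real.exp_add]
  congr 2
  field_simp
  ring

lemma integrableOn_tau (σ x : ℝ) (hσ : 0 < σ) :
    IntegrableOn (fun u => Real.exp (-u * x - u ^ 2 * σ ^ 2 / 2)) (Set.Ioi 0) := by
  have h1 : Integrable (fun u => stdPDF (x / σ + σ * u)) :=
    (integrable_stdPDF.comp_add_left (x / σ)).comp_mul_left' hσ.ne'
  have h2 : (fun u => Real.exp (-u * x - u ^ 2 * σ ^ 2 / 2)) =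
      fun u => (stdPDF (x / σ))⁻¹ * stdPDF (x / σ + σ * u) := by
    ext u
    rw [stdPDF_shift _ _ _ hσ, inv_mul_cancel_left₀ (stdPDF_pos _).ne']
  rw [h2]
  exact (h1.const_mul _).integrableOn

lemma millsTau_eq (σ x : ℝ) (hσ : 0 < σ) :
    millsTau σ x = ∫ u in Set.Ioi 0, Real.exp (-u * x - u ^ 2 * σ ^ 2 / 2) := by
  have h2 : (fun u => Real.exp (-u * x - u ^ 2 * σ ^ 2 / 2)) =
      fun u => (stdPDF (x / σ))⁻¹ * stdPDF (x / σ + σ * u) := by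
    ext u
    rw [stdPDF_shift _ _ _ hσ, inv_mul_cancel_left₀ (stdPDF_pos _).ne']
  rw [h2, integral_const_mul,
    integral_comp_mul_left_Ioi (fun v => stdPDF (x / σ + v)) 0 hσ]
  have h3 : ∫ v in Set.Ioi (σ * 0), stdPDF (x / σ + v) = ∫ t in Set.Ioi (x / σ), stdPDF t := by
    have := (measurePreserving_add_left volume (x / σ)).setIntegral_preimage_emb
      (measurableEmbedding_addLeft (x / σ)) stdPDF (Set.Ioi (x / σ))
    rw [← this]
    simp
  rw [h3, millsTau, one_sub_stdCDF]
  simp only [smul_eq_mul]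
  field_simp

lemma millsTau_nonneg (σ x : ℝ) (hσ : 0 < σ) : 0 ≤ millsTau σ x := by
  rw [millsTau_eq σ x hσ]
  exact integral_nonneg fun u => (Real.exp_pos _).le

lemma measurable_millsTau (σ : ℝ) (hσ : 0 < σ) : Measurable (millsTau σ) := by
  have : millsTau σ = fun x => ∫ u in Set.Ioi 0, Real.exp (-u * x - u ^ 2 * σ ^ 2 / 2) := by
    ext x; exact millsTau_eq σ x hσ
  rw [this]
  refine StronglyMeasurable.measurable ?_
  refine StronglyMeasurable.integral_prod_right
    (f := fun (x : ℝ) (u : ℝ) => Real.exp (-u * x - u ^ 2 * σ ^ 2 / 2)) ?_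
  exact (by fun_prop : Measurable fun p : ℝ × ℝ =>
    Real.exp (-p.2 * p.1 - p.2 ^ 2 * σ ^ 2 / 2)).stronglyMeasurable

/-- Integrability and mean of the Mills ratio under a Gaussian law. -/
lemma tau_gaussian (σ m : ℝ) (v : NNReal) (hσ : 0 < σ)
    (h : IntegrableOn (fun u => Real.exp (-u * m - u ^ 2 * (σ ^ 2 - v) / 2)) (Set.Ioi 0)) :
    Integrable (millsTau σ) (gaussianReal m v) ∧
    ∫ x, millsTau σ x ∂(gaussianReal m v) =
      ∫ u in Set.Ioi 0, Real.exp (-u * m - u ^ 2 * (σ ^ 2 - v) / 2) := by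
  have hinner : ∀ u : ℝ, ∫ x, Real.exp (-u * x - u ^ 2 * σ ^ 2 / 2) ∂(gaussianReal m v) =
      Real.exp (-u * m - u ^ 2 * (σ ^ 2 - v) / 2) := by
    intro u
    have h1 := congrFun (mgf_fun_id_gaussianReal (μ := m) (v := v)) (-u)
    unfold mgf at h1
    simp_rw [sub_eq_add_neg, Real.exp_add]
    rw [integral_mul_const, h1, ← Real.exp_add, ← Real.exp_add]
    congr 1; ring
  have hint : Integrable (Function.uncurry fun (u x : ℝ) =>
      Real.exp (-u * x - u ^ 2 * σ ^ 2 / 2))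
      ((volume.restrict (Set.Ioi 0)).prod (gaussianReal m v)) := by
    rw [integrable_prod_iff]
    · constructor
      · refine Eventually.of_forall fun u => ?_
        simp only [Function.uncurry]
        simp_rw [sub_eq_add_neg, Real.exp_add]
        exact (integrable_exp_mul_gaussianReal (-u)).mul_const _
      · simp only [Function.uncurry, Real.norm_eq_abs, Real.abs_exp, hinner]
        exact h
    · exact (by fun_prop : Measurable fun p : ℝ × ℝ =>
        Real.exp (-p.1 * p.2 - p.1 ^ 2 * σ ^ 2 / 2)).aestronglyMeasurable
  have hτ : millsTau σ = fun x => ∫ u in Set.Ioi 0, Real.exp (-u * x - u ^ 2 * σ ^ 2 / 2) := by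
    ext x; exact millsTau_eq σ x hσ
  rw [hτ]
  constructor
  · exact hint.integral_prod_right
  · rw [← integral_integral_swap hint]
    simp_rw [hinner]

/-- Mean of `betaU` for a jointly Gaussian pair. -/
lemma betaU_gaussian {Ω : Type*} [MeasurableSpace Ω] (P : Measure Ω) [IsProbabilityMeasure P]
    (X Y : Ω → ℝ) (hXY : HasGaussianLaw (fun ω => (X ω, Y ω)) P)
    (s₁₂ s₂₂ c m₁ m₂ : ℝ) (hs : 0 < s₂₂) (hc : 0 < c)
    (hm₁ : P[X] = m₁) (hm₂ : P[Y] = m₂)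
    (hcov : cov[X, Y; P] = c * s₁₂) (hvar : Var[Y; P] = c * s₂₂)
    (h : IntegrableOn (fun u => Real.exp (-u * m₂ - u ^ 2 * (s₂₂ - c * s₂₂) / 2)) (Set.Ioi 0)) :
    Integrable (fun ω => betaU (X ω) (Y ω) s₁₂ s₂₂) P ∧
    ∫ ω, betaU (X ω) (Y ω) s₁₂ s₂₂ ∂P =
      (∫ u in Set.Ioi 0, Real.exp (-u * m₂ - u ^ 2 * (s₂₂ - c * s₂₂) / 2)) *
        (m₁ - s₁₂ / s₂₂ * m₂) + s₁₂ / s₂₂ := by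
  have hσ : 0 < Real.sqrt s₂₂ := Real.sqrt_pos.2 hs
  have hX := hXY.fst
  have hY := hXY.snd
  have hXi := hX.integrable
  have hYi := hY.integrable
  have hlaw := hY.map_eq_gaussianReal
  rw [hm₂, hvar] at hlaw
  have hv : ((c * s₂₂).toNNReal : ℝ) = c * s₂₂ := Real.coe_toNNReal _ (by positivity)
  have key := tau_gaussian (Real.sqrt s₂₂) m₂ (c * s₂₂).toNNReal hσ
    (by rw [hv, Real.sq_sqrt hs.le]; exact h)
  rw [hv, Real.sq_sqrt hs.le, ← hlaw] at key
  have hτm := measurable_millsTau _ hσ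
  rw [integral_map hY.aemeasurable hτm.aestronglyMeasurable,
    integrable_map_measure hτm.aestronglyMeasurable hY.aemeasurable] at key
  obtain ⟨hτi, hτe⟩ := key
  have hW : HasGaussianLaw (fun ω => (Y ω, X ω - s₁₂ / s₂₂ * Y ω)) P := by
    have := hXY.map_fun ((ContinuousLinearMap.snd ℝ ℝ ℝ).prod
      (ContinuousLinearMap.fst ℝ ℝ ℝ - (s₁₂ / s₂₂) • ContinuousLinearMap.snd ℝ ℝ ℝ))
    simpa using this
  have hind : IndepFun Y (fun ω => X ω - s₁₂ / s₂₂ * Y ω) P := by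
    refine hW.indepFun_of_covariance_eq_zero ?_
    rw [covariance_fun_sub_right hY.memLp_two hX.memLp_two (hY.memLp_two.const_mul _),
      covariance_const_mul_right, covariance_comm, hcov, covariance_self hY.aemeasurable, hvar]
    field_simp
    ring
  have hDi : Integrable (fun ω => X ω - s₁₂ / s₂₂ * Y ω) P := hXi.sub (hYi.const_mul _)
  have hind2 : IndepFun (fun ω => millsTau (Real.sqrt s₂₂) (Y ω))
      (fun ω => X ω - s₁₂ / s₂₂ * Y ω) P := hind.comp hτm measurable_id
  have hprod : Integrable (fun ω => millsTau (Real.sqrt s₂₂) (Y ω) *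
      (X ω - s₁₂ / s₂₂ * Y ω)) P := hind2.integrable_mul hτi hDi
  unfold betaU
  refine ⟨hprod.add (integrable_const _), ?_⟩
  rw [integral_add hprod (integrable_const _),
    hind2.integral_fun_mul_eq_mul_integral hτi.aestronglyMeasurable hDi.aestronglyMeasurable,
    integral_sub hXi (hYi.const_mul _), integral_const_mul, hm₁, hm₂, hτe]
  simp

lemma measurable_betaU_comp {α : Type*} [MeasurableSpace α] (s₁₂ s₂₂ : ℝ) (hs : 0 < s₂₂)
    (X Y : α → ℝ) (hX : Measurable X) (hY : Measurable Y) :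
    Measurable fun a => betaU (X a) (Y a) s₁₂ s₂₂ := by
  unfold betaU
  have := (measurable_millsTau _ (Real.sqrt_pos.2 hs)).comp hY
  simp only [Function.comp_def] at this
  fun_prop

set_option maxHeartbeats 1000000 in
lemma mvGaussian_facts {ι : Type*} [Fintype ι] (μ : ι → ℝ) (A : Matrix ι ι ℝ) :
    IsGaussian (mvGaussian μ A) ∧ (∀ i, ∫ x, x i ∂(mvGaussian μ A) = μ i) ∧
    ∀ i j, cov[fun x => x i, fun x => x j; mvGaussian μ A] = (A * Aᵀ) i j := by
  classical
  set ν : Measure (ι → ℝ) := Measure.pi fun _ : ι => gaussianReal 0 1 with hν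
  have hlaw : ∀ i, ν.map (fun z => z i) = gaussianReal 0 1 := fun i =>
    (measurePreserving_eval (fun _ : ι => gaussianReal 0 1) i).map_eq
  have hg : ∀ i, HasGaussianLaw (fun z : ι → ℝ => z i) ν := fun i =>
    ⟨by rw [hlaw]; infer_instance⟩
  have hindep : iIndepFun (fun i (z : ι → ℝ) => z i) ν :=
    iIndepFun_pi (X := fun _ => id) (fun i => aemeasurable_id)
  have hz : HasGaussianLaw (fun z : ι → ℝ => z) ν := hindep.hasGaussianLaw hg
  have hmean : ∀ i, ∫ z, z i ∂ν = 0 := by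
    intro i
    have := integral_map (μ := ν) (φ := fun z => z i) (measurable_pi_apply i).aemeasurable
      (f := fun x : ℝ => x) (by fun_prop)
    rw [← this, hlaw]; simp
  have hcov : ∀ i j, cov[fun z => z i, fun z => z j; ν] = if i = j then 1 else 0 := by
    intro i j
    split_ifs with hij
    · subst hij
      rw [covariance_self (measurable_pi_apply i).aemeasurable]
      have := variance_map (μ := ν) (Y := fun z => z i) (X := fun x : ℝ => x)
        (by fun_prop) (measurable_pi_apply i).aemeasurable
      rw [hlaw] at this
      simpa [Function.comp_def] using this.symm
    · exact (hindep.indepFun hij).covariance_eq_zero (hg i).memLp_two (hg j).memLp_two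
  have hm : Measurable (fun z : ι → ℝ => μ + A.mulVec z) := by fun_prop
  have happ : ∀ (z : ι → ℝ) i, (μ + A.mulVec z) i = μ i + ∑ j, A i j * z j := by
    intro z i; simp [Matrix.mulVec, dotProduct]
  have hi : ∀ j, Integrable (fun z : ι → ℝ => z j) ν := fun j => (hg j).integrable
  have hsi : ∀ i, Integrable (fun z : ι → ℝ => ∑ j, A i j * z j) ν := fun i =>
    integrable_finsetSum _ fun j _ => (hi j).const_mul _
  refine ⟨?_, ?_, ?_⟩
  · have h1 : IsGaussian (ν.map (LinearMap.toContinuousLinearMap A.mulVecLin)) := by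
      have : IsGaussian ν := by simpa using hz.isGaussian_map
      infer_instance
    have h2 : mvGaussian μ A =
        (ν.map (LinearMap.toContinuousLinearMap A.mulVecLin)).map (fun x => x + μ) := by
      rw [Measure.map_map (by fun_prop) (by fun_prop)]
      unfold mvGaussian
      congr 1
      ext z i
      simp [add_comm]
    rw [h2]
    infer_instance
  · intro i
    unfold mvGaussian
    rw [integral_map hm.aemeasurable (measurable_pi_apply i).aestronglyMeasurable]
    simp_rw [happ]
    rw [integral_add (integrable_const _) (hsi i),
      integral_finsetSum _ fun j _ => (hi j).const_mul _]
    simp_rw [integral_const_mul]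
    simp [hmean]
  · intro i j
    unfold mvGaussian
    rw [covariance_map_fun (measurable_pi_apply i).aestronglyMeasurable
      (measurable_pi_apply j).aestronglyMeasurable hm.aemeasurable]
    simp_rw [happ]
    rw [covariance_const_add_left (hsi i), covariance_const_add_right (hsi j),
      covariance_fun_sum_fun_sum (fun k => (hg k).memLp_two.const_mul _)
        (fun k => (hg k).memLp_two.const_mul _)]
    have hab : ∀ a b, cov[fun z : ι → ℝ => A i a * z a, fun z => A j b * z b; ν] =
        A i a * (A j b * if a = b then 1 else 0) := by
      intro a b
      rw [covariance_const_mul_left, covariance_const_mul_right, hcov]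
    refine (Finset.sum_congr rfl fun a _ => Finset.sum_congr rfl fun b _ => hab a b).trans ?_
    simp [Matrix.mul_apply]

set_option maxHeartbeats 1000000 in
theorem stmt15 {Ω : Type*} [MeasurableSpace Ω] (P : Measure Ω) [IsProbabilityMeasure P]
    (k : ℕ) (β : ℝ) (π : Fin k → ℝ) (hπ : ∀ i, 0 < π i)
    (A : Matrix (Fin 2 × Fin k) (Fin 2 × Fin k) ℝ) (hA : (A * Aᵀ).PosDef)
    (ξ ζ : Ω → (Fin 2 × Fin k) → ℝ) (hmξ : Measurable ξ) (hmζ : Measurable ζ)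
    (hind : IndepFun ξ ζ P)
    (hξ : P.map ξ = mvGaussian (fun p => if p.1 = 0 then β * π p.2 else π p.2) A)
    (hζ : P.map ζ = mvGaussian 0 A)
    (w : Fin k → ℝ) (hws : ∑ i, w i = 1) :
    P[(fun ω => ∑ i, w i *
        betaU ((ξ ω + ζ ω) (0, i)) ((ξ ω + ζ ω) (1, i))
          (2 * (A * Aᵀ) (0, i) (1, i)) (2 * (A * Aᵀ) (1, i) (1, i)))
      | MeasurableSpace.comap ξ inferInstance]
      =ᵐ[P] fun ω => ∑ i, w i *
        betaU (ξ ω (0, i)) (ξ ω (1, i))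
          ((A * Aᵀ) (0, i) (1, i)) ((A * Aᵀ) (1, i) (1, i)) := by
  have hpos : ∀ i, 0 < (A * Aᵀ) (1, i) (1, i) := fun i => hA.diag_pos
  obtain ⟨S, hS⟩ : ∃ S, S = A * Aᵀ := ⟨_, rfl⟩
  rw [← hS] at hpos ⊢
  -- measurability
  have hfm : ∀ i, Measurable fun p : ((Fin 2 × Fin k) → ℝ) × ((Fin 2 × Fin k) → ℝ) =>
      betaU ((p.1 + p.2) (0, i)) ((p.1 + p.2) (1, i)) (2 * S (0, i) (1, i))
        (2 * S (1, i) (1, i)) := by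
    intro i
    refine measurable_betaU_comp _ _ (mul_pos two_pos (hpos i)) _ _ ?_ ?_
    · simp only [Pi.add_apply]; fun_prop
    · simp only [Pi.add_apply]; fun_prop
  -- Gaussian facts
  obtain ⟨gξ, mξ, cξ⟩ := mvGaussian_facts (fun p : Fin 2 × Fin k => if p.1 = 0 then β * π p.2 else π p.2) A
  obtain ⟨gζ, mζ, cζ⟩ := mvGaussian_facts (0 : Fin 2 × Fin k → ℝ) A
  rw [← hξ] at gξ mξ cξ
  rw [← hζ] at gζ mζ cζ
  have Gξ : HasGaussianLaw ξ P := ⟨gξ⟩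
  have Gζ : HasGaussianLaw ζ P := ⟨gζ⟩
  have mξ' : ∀ p, ∫ ω, ξ ω p ∂P = if p.1 = 0 then β * π p.2 else π p.2 := by
    intro p; rw [← mξ p, integral_map hmξ.aemeasurable (measurable_pi_apply p).aestronglyMeasurable]
  have mζ' : ∀ p, ∫ ω, ζ ω p ∂P = 0 := by
    intro p
    have := mζ p
    rw [integral_map hmζ.aemeasurable (measurable_pi_apply p).aestronglyMeasurable] at this
    simpa using this
  have cξ' : ∀ p q, cov[fun ω => ξ ω p, fun ω => ξ ω q; P] = S p q := by
    intro p q; rw [hS, ← cξ p q, covariance_map_fun (measurable_pi_apply p).aestronglyMeasurable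
      (measurable_pi_apply q).aestronglyMeasurable hmξ.aemeasurable]
  have cζ' : ∀ p q, cov[fun ω => ζ ω p, fun ω => ζ ω q; P] = S p q := by
    intro p q; rw [hS, ← cζ p q, covariance_map_fun (measurable_pi_apply p).aestronglyMeasurable
      (measurable_pi_apply q).aestronglyMeasurable hmζ.aemeasurable]
  have Gξp : ∀ p, HasGaussianLaw (fun ω => ξ ω p) P := fun p =>
    Gξ.map_fun (ContinuousLinearMap.proj p)
  have Gζp : ∀ p, HasGaussianLaw (fun ω => ζ ω p) P := fun p =>
    Gζ.map_fun (ContinuousLinearMap.proj p)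
  have Gsum : HasGaussianLaw (fun ω => ξ ω + ζ ω) P := iIndepFun.hasGaussianLaw_fun_add Gξ Gζ hind
  have c0 : ∀ p q, cov[fun ω => ξ ω p, fun ω => ζ ω q; P] = 0 := fun p q =>
    (hind.comp (measurable_pi_apply p) (measurable_pi_apply q)).covariance_eq_zero
      (Gξp p).memLp_two (Gζp q).memLp_two
  have csum : ∀ p q, cov[fun ω => (ξ ω + ζ ω) p, fun ω => (ξ ω + ζ ω) q; P] = 2 * S p q := by
    intro p q
    have e : ∀ p, (fun ω => (ξ ω + ζ ω) p) = (fun ω => ξ ω p) + (fun ω => ζ ω p) := fun p => rfl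
    rw [e, e, covariance_add_left (Gξp p).memLp_two (Gζp p).memLp_two
      ((Gξp q).memLp_two.add (Gζp q).memLp_two),
      covariance_add_right (Gξp p).memLp_two (Gξp q).memLp_two (Gζp q).memLp_two,
      covariance_add_right (Gζp p).memLp_two (Gξp q).memLp_two (Gζp q).memLp_two,
      cξ', cζ', c0, covariance_comm, c0]
    ring
  have msum : ∀ p, ∫ ω, (ξ ω + ζ ω) p ∂P = if p.1 = 0 then β * π p.2 else π p.2 := by
    intro p
    have := integral_add (Gξp p).integrable (Gζp p).integrable
    rw [mξ', mζ', add_zero] at this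
    exact this
  -- integrability
  have hint : ∀ i, Integrable (fun ω => betaU ((ξ ω + ζ ω) (0, i)) ((ξ ω + ζ ω) (1, i))
      (2 * S (0, i) (1, i)) (2 * S (1, i) (1, i))) P := by
    intro i
    have hp := hpos i
    refine (betaU_gaussian P (fun ω => (ξ ω + ζ ω) (0, i)) (fun ω => (ξ ω + ζ ω) (1, i)) ?_
      (2 * S (0, i) (1, i)) (2 * S (1, i) (1, i)) 1 (β * π i) (π i) (by positivity) one_pos
      ?_ ?_ ?_ ?_ ?_).1
    · exact Gsum.map_fun ((ContinuousLinearMap.proj (R := ℝ) (φ := fun _ : Fin 2 × Fin k => ℝ)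
        (0, i)).prod (ContinuousLinearMap.proj (1, i)))
    · rw [msum]; simp
    · rw [msum]; simp
    · rw [csum]; ring
    · have hae : AEMeasurable (fun ω => (ξ ω + ζ ω) (1, i)) P :=
        (Gsum.map_fun (ContinuousLinearMap.proj
          (R := ℝ) (φ := fun _ : Fin 2 × Fin k => ℝ) (1, i))).aemeasurable
      rw [← covariance_self hae, csum]; ring
    · have := exp_neg_integrableOn_Ioi 0 (hπ i)
      refine this.congr_fun (fun u _ => ?_) measurableSet_Ioi
      simp only
      congr 1; ring
  -- value
  have hval : ∀ (x : (Fin 2 × Fin k) → ℝ) i,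
      Integrable (fun ω => betaU ((x + ζ ω) (0, i)) ((x + ζ ω) (1, i))
        (2 * S (0, i) (1, i)) (2 * S (1, i) (1, i))) P ∧
      ∫ ω, betaU ((x + ζ ω) (0, i)) ((x + ζ ω) (1, i))
        (2 * S (0, i) (1, i)) (2 * S (1, i) (1, i)) ∂P =
      betaU (x (0, i)) (x (1, i)) (S (0, i) (1, i)) (S (1, i) (1, i)) := by
    intro x i
    have hp := hpos i
    have hσ := Real.sqrt_pos.2 hp
    have Gx : HasGaussianLaw (fun ω => x + ζ ω) P := by
      refine ⟨?_⟩
      have : P.map (fun ω => x + ζ ω) = (P.map ζ).map (fun y => y + x) := by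
        rw [Measure.map_map (by fun_prop) hmζ]
        congr 1
        ext ω
        simp [add_comm]
      rw [this]; infer_instance
    have mx : ∀ p, ∫ ω, (x + ζ ω) p ∂P = x p := by
      intro p
      have := integral_add (integrable_const (x p)) (Gζp p).integrable
      rw [mζ', add_zero] at this
      simpa using this
    have cx : ∀ p q, cov[fun ω => (x + ζ ω) p, fun ω => (x + ζ ω) q; P] = S p q := by
      intro p q
      simp only [Pi.add_apply]
      rw [covariance_const_add_left (Gζp p).integrable,
        covariance_const_add_right (Gζp q).integrable, cζ']
    have efun : (fun u => Real.exp (-u * x (1, i) - u ^ 2 *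
        (2 * S (1, i) (1, i) - 1 / 2 * (2 * S (1, i) (1, i))) / 2)) =
        fun u => Real.exp (-u * x (1, i) - u ^ 2 * (Real.sqrt (S (1, i) (1, i))) ^ 2 / 2) := by
      ext u
      rw [Real.sq_sqrt hp.le]
      congr 1; ring
    have hae : AEMeasurable (fun ω => (x + ζ ω) (1, i)) P :=
      (Gx.map_fun (ContinuousLinearMap.proj
        (R := ℝ) (φ := fun _ : Fin 2 × Fin k => ℝ) (1, i))).aemeasurable
    have main := betaU_gaussian P (fun ω => (x + ζ ω) (0, i)) (fun ω => (x + ζ ω) (1, i))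
      (Gx.map_fun ((ContinuousLinearMap.proj (R := ℝ) (φ := fun _ : Fin 2 × Fin k => ℝ)
        (0, i)).prod (ContinuousLinearMap.proj (1, i))))
      (2 * S (0, i) (1, i)) (2 * S (1, i) (1, i)) (1 / 2) (x (0, i)) (x (1, i)) (by positivity)
      (by norm_num) (mx _) (mx _) (by rw [cx]; ring)
      (by rw [← covariance_self hae, cx]; ring)
      (by rw [efun]; exact integrableOn_tau _ _ hσ)
    refine ⟨main.1, ?_⟩
    rw [main.2, efun, ← millsTau_eq _ _ hσ, betaU,
      mul_div_mul_left _ _ (two_ne_zero : (2 : ℝ) ≠ 0)]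
  -- conditional expectation
  let f : ((Fin 2 × Fin k) → ℝ) × ((Fin 2 × Fin k) → ℝ) → ℝ := fun p => ∑ i, w i *
      betaU ((p.1 + p.2) (0, i)) ((p.1 + p.2) (1, i)) (2 * S (0, i) (1, i))
        (2 * S (1, i) (1, i))
  have hf : StronglyMeasurable f :=
    (Finset.measurable_sum _ fun i _ => (hfm i).const_mul (w i)).stronglyMeasurable
  have hfi : Integrable (fun ω => f (ξ ω, ζ ω)) P :=
    integrable_finsetSum _ fun i _ => (hint i).const_mul (w i)
  have h1 := condExp_prod_ae_eq_integral_condDistrib hmξ hmζ.aemeasurable hf hfi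
  have h2 : condDistrib ζ ξ P =ᵐ[P.map ξ] Kernel.const _ (P.map ζ) := by
    have : IsProbabilityMeasure (P.map ζ) := Measure.isProbabilityMeasure_map hmζ.aemeasurable
    have : IsProbabilityMeasure (P.map ξ) := Measure.isProbabilityMeasure_map hmξ.aemeasurable
    refine condDistrib_ae_eq_of_measure_eq_compProd ξ hmζ.aemeasurable ?_
    rw [Measure.compProd_const]
    exact (indepFun_iff_map_prod_eq_prod_map_map hmξ.aemeasurable hmζ.aemeasurable).1 hind
  have h3 := ae_of_ae_map hmξ.aemeasurable h2
  refine h1.trans ?_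
  filter_upwards [h3] with ω hω
  have hfs : AEStronglyMeasurable (fun y => f (ξ ω, y)) (P.map ζ) :=
    (hf.comp_measurable measurable_prodMk_left).aestronglyMeasurable
  rw [hω, Kernel.const_apply, integral_map hmζ.aemeasurable hfs]
  simp only [f]
  rw [integral_finsetSum _ fun i _ => (hval (ξ ω) i).1.const_mul (w i)]
  simp_rw [integral_const_mul, (hval (ξ ω) _).2]
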